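/- arXiv:1709.07824 — 9 statements merged into one kernel-verified Lean document; each statement's English description precedes it below -/
import Mathlib

section
/- Let X and V be real Banach spaces, U an open neighborhood of a point x0 in X, and F : U × (−ε0, ε0) → V a map which, for each ε, is continuously Fréchet differentiable in its first argument, with derivative F'(x,ε). Assume there are constants C1, C2, C3 > 0 and real exponents α, β with 0 ≤ 2α < β such that for all ε with 0 < |ε| < ε0: (i) ‖F(x0,ε)‖ ≤ C1|ε|^β; (ii) F'(x0,ε) is a continuously invertible linear map with ‖[F'(x0,ε)]^{−1}‖ ≤ C2|ε|^{−α}; (iii) ‖F'(z,ε) − F'(x0,ε)‖ ≤ C3‖z − x0‖ for all z ∈ U. Then there exist constants C0 > 0 and ε* > 0 such that for every ε with 0 < |ε| < ε*, there exists a unique point x*(ε) in the closed ball of radius C0|ε|^{β−α} around x0 satisfying F(x*(ε), ε) = 0. -/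
/-- A 1/2-Lipschitz map of a closed ball moving the centre by at most `r/2` has a unique
fixed point in the ball. -/
theorem nk_fixedPoint {X : Type*} [NormedAddCommGroup X] [CompleteSpace X]
    (T : X → X) (x0 : X) (r : ℝ) (hr : 0 ≤ r)
    (hT : ∀ x ∈ Metric.closedBall x0 r, ∀ y ∈ Metric.closedBall x0 r,
      ‖T x - T y‖ ≤ 1 / 2 * ‖x - y‖)
    (h0 : ‖T x0 - x0‖ ≤ r / 2) :
    ∃! x : X, x ∈ Metric.closedBall x0 r ∧ T x = x := by
  have hx0 : x0 ∈ Metric.closedBall x0 r := Metric.mem_closedBall_self hr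
  have hmaps : Set.MapsTo T (Metric.closedBall x0 r) (Metric.closedBall x0 r) := by
    intro x hx
    have h := hT x hx x0 hx0
    rw [mem_closedBall_iff_norm] at hx ⊢
    have h2 := norm_add_le (T x - T x0) (T x0 - x0)
    rw [sub_add_sub_cancel] at h2
    linarith
  have hcon : ContractingWith (1 / 2) (hmaps.restrict T _ _) := by
    refine ⟨by rw [← NNReal.coe_lt_coe]; norm_num, LipschitzWith.of_dist_le_mul ?_⟩
    rintro ⟨x, hx⟩ ⟨y, hy⟩
    have := hT x hx y hy
    rw [← dist_eq_norm, ← dist_eq_norm] at this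
    simpa [Subtype.dist_eq] using this
  obtain ⟨y, hy, hfix, -⟩ := hcon.exists_fixedPoint' Metric.isClosed_closedBall.isComplete
    hmaps hx0 (edist_ne_top _ _)
  refine ⟨y, ⟨hy, hfix⟩, ?_⟩
  rintro z ⟨hz, hzfix⟩
  have h := hT z hz y hy
  rw [hzfix, hfix.eq] at h
  have h3 : ‖z - y‖ = 0 := le_antisymm (by linarith) (norm_nonneg _)
  exact sub_eq_zero.1 (norm_eq_zero.1 h3)

/-- Newton–Kantorovich proposition: if `F(x0,ε)` is `O(|ε|^β)`, the derivative
`F'(x0,ε)` is invertible with inverse bounded by `C2 |ε|^{-α}` (with `0 ≤ 2α < β`),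
and `F'(·,ε)` is Lipschitz around `x0`, then for small `ε ≠ 0` there is a unique
zero of `F(·,ε)` in the closed ball of radius `C0 |ε|^{β-α}` around `x0`. -/
theorem newton_kantorovich
    {X V : Type*} [NormedAddCommGroup X] [NormedSpace ℝ X] [CompleteSpace X]
    [NormedAddCommGroup V] [NormedSpace ℝ V] [CompleteSpace V]
    (U : Set X) (hU : IsOpen U) (x0 : X) (hx0 : x0 ∈ U)
    (ε0 : ℝ) (hε0 : 0 < ε0)
    (F : X → ℝ → V) (F' : X → ℝ → (X →L[ℝ] V))
    (hdiff : ∀ ε : ℝ, |ε| < ε0 → ∀ x ∈ U, HasFDerivAt (fun y => F y ε) (F' x ε) x)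
    (hcont : ∀ ε : ℝ, |ε| < ε0 → ContinuousOn (fun x => F' x ε) U)
    (C1 C2 C3 : ℝ) (hC1 : 0 < C1) (hC2 : 0 < C2) (hC3 : 0 < C3)
    (α β : ℝ) (hα : 0 ≤ α) (hαβ : 2 * α < β)
    (h1 : ∀ ε : ℝ, 0 < |ε| → |ε| < ε0 → ‖F x0 ε‖ ≤ C1 * |ε| ^ β)
    (hinv : ∀ ε : ℝ, 0 < |ε| → |ε| < ε0 → ∃ G : V →L[ℝ] X,
      (∀ v, F' x0 ε (G v) = v) ∧ (∀ x, G (F' x0 ε x) = x) ∧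
        ‖G‖ ≤ C2 * |ε| ^ (-α))
    (hlip : ∀ ε : ℝ, 0 < |ε| → |ε| < ε0 → ∀ z ∈ U,
      ‖F' z ε - F' x0 ε‖ ≤ C3 * ‖z - x0‖) :
    ∃ C0 > (0 : ℝ), ∃ εstar > (0 : ℝ), ∀ ε : ℝ, 0 < |ε| → |ε| < εstar →
      ∃! x : X, x ∈ Metric.closedBall x0 (C0 * |ε| ^ (β - α)) ∧ F x ε = 0 := by
  have hcontr : ∀ C γ : ℝ, 0 < γ → ∀ δ > 0, ∃ η > 0, ∀ t : ℝ, 0 < t → t < η →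
      C * t ^ γ < δ := by
    intro C γ hγ δ hδ
    have hc : ContinuousAt (fun t : ℝ => C * t ^ γ) 0 :=
      continuousAt_const.mul (Real.continuousAt_rpow_const _ _ (Or.inr hγ.le))
    obtain ⟨η, hη, h⟩ := Metric.continuousAt_iff.1 hc δ hδ
    refine ⟨η, hη, fun t ht htη => ?_⟩
    have h' := h (x := t) (by simpa [abs_of_pos ht] using htη)
    rw [Real.dist_eq, Real.zero_rpow hγ.ne', mul_zero, sub_zero] at h'
    exact (le_abs_self _).trans_lt h'
  obtain ⟨ρ, hρ, hball⟩ := Metric.isOpen_iff.1 hU x0 hx0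
  obtain ⟨η1, hη1, H1⟩ := hcontr (2 * C1 * C2) (β - α) (by linarith) ρ hρ
  obtain ⟨η2, hη2, H2⟩ := hcontr (2 * C1 * C2 * C2 * C3) (β - 2 * α) (by linarith) (1 / 2)
    (by norm_num)
  refine ⟨2 * C1 * C2, by positivity, min ε0 (min η1 η2), by positivity, ?_⟩
  intro ε hε hεs
  obtain ⟨hs0, hs⟩ := lt_min_iff.1 hεs
  obtain ⟨hs1, hs2⟩ := lt_min_iff.1 hs
  obtain ⟨G, hG1, hG2, hG⟩ := hinv ε hε hs0
  have hr : 2 * C1 * C2 * |ε| ^ (β - α) < ρ := H1 _ hε hs1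
  have hk := H2 _ hε hs2
  have hr0 : 0 ≤ 2 * C1 * C2 * |ε| ^ (β - α) := by positivity
  have hpow1 : |ε| ^ (-α) * |ε| ^ β = |ε| ^ (β - α) := by
    rw [← Real.rpow_add hε]; congr 1; ring
  have hpow2 : |ε| ^ (-α) * |ε| ^ (β - α) = |ε| ^ (β - 2 * α) := by
    rw [← Real.rpow_add hε]; congr 1; ring
  have hsub : Metric.closedBall x0 (2 * C1 * C2 * |ε| ^ (β - α)) ⊆ U :=
    (Metric.closedBall_subset_ball hr).trans hball
  have hGinj : ∀ v, G v = 0 → v = 0 := fun v hv => by rw [← hG1 v, hv, map_zero]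
  have key := nk_fixedPoint (fun x => x - G (F x ε)) x0 _ hr0 ?_ ?_
  · have hiff : ∀ x, x - G (F x ε) = x ↔ F x ε = 0 := by
      intro x
      rw [sub_eq_self]
      exact ⟨hGinj _, fun h => by rw [h, map_zero]⟩
    simpa only [hiff] using key
  · intro x hx y hy
    refine (convex_closedBall x0 _).norm_image_sub_le_of_norm_hasFDerivWithin_le
      (f := fun x => x - G (F x ε)) (C := 1 / 2)
      (f' := fun z => ContinuousLinearMap.id ℝ X - G.comp (F' z ε)) (𝕜 := ℝ) ?_ ?_ hy hx
    · intro z hz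
      exact ((hasFDerivAt_id z).sub
        (G.hasFDerivAt.comp z (hdiff ε hs0 z (hsub hz)))).hasFDerivWithinAt
    · intro z hz
      have heq : ContinuousLinearMap.id ℝ X - G.comp (F' z ε)
          = -(G.comp (F' z ε - F' x0 ε)) := by
        ext v
        simp [hG2]
      rw [heq, norm_neg]
      have hz' := hlip ε hε hs0 z (hsub hz)
      rw [mem_closedBall_iff_norm] at hz
      calc ‖G.comp (F' z ε - F' x0 ε)‖ ≤ ‖G‖ * ‖F' z ε - F' x0 ε‖ :=
            ContinuousLinearMap.opNorm_comp_le _ _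
        _ ≤ (C2 * |ε| ^ (-α)) * (C3 * (2 * C1 * C2 * |ε| ^ (β - α))) := by
            gcongr
            exact hz'.trans (by gcongr)
        _ = 2 * C1 * C2 * C2 * C3 * (|ε| ^ (-α) * |ε| ^ (β - α)) := by ring
        _ ≤ 1 / 2 := by rw [hpow2]; exact hk.le
  · have : x0 - G (F x0 ε) - x0 = -(G (F x0 ε)) := by abel
    simp only [this, norm_neg]
    calc ‖G (F x0 ε)‖ ≤ ‖G‖ * ‖F x0 ε‖ := G.le_opNorm _
      _ ≤ (C2 * |ε| ^ (-α)) * (C1 * |ε| ^ β) := by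
          gcongr
          exact h1 ε hε hs0
      _ = C1 * C2 * (|ε| ^ (-α) * |ε| ^ β) := by ring
      _ = _ := by rw [hpow1]; ring
end

section
/- Let U ⊆ ℝ^m be open, x0 ∈ U, ε0 > 0, and let Υ : U × (0, ε0) → ℝ^m be continuously differentiable in its first argument with Jacobian D_xΥ. Let r, α be real numbers with 0 ≤ 2α < r. Assume there are constants C1, C2, C3 > 0 such that for all ε ∈ (0, ε0): (i) ‖Υ(x0, ε)‖ ≤ C1 ε^r; (ii) the matrix M(ε) = D_xΥ(x0, ε) is invertible and ‖M(ε)^{−1}‖ ≤ C2 ε^{−α}; (iii) ‖D_xΥ(z, ε) − D_xΥ(x0, ε)‖ ≤ C3 ‖z − x0‖ for all z ∈ U. Then there exist C0 > 0 and ε* ∈ (0, ε0] such that for every ε ∈ (0, ε*) there exists a unique point x*(ε) in the closed ball of radius C0 ε^{r−α} around x0 with Υ(x*(ε), ε) = 0. -/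
/-- Finite-dimensional continuation theorem for the period map `Υ`: an approximate
zero `x0` of order `ε^r`, together with an inverse-Jacobian bound of order `ε^{-α}`
with `0 ≤ 2α < r` and a Lipschitz estimate on the Jacobian, yields for every small
`ε > 0` a unique true zero within distance `C0 ε^{r-α}` of `x0`. -/
theorem continuation_of_periodic_orbits
    (m : ℕ) (hm : 1 ≤ m)
    (U : Set (EuclideanSpace ℝ (Fin m))) (hU : IsOpen U)
    (x0 : EuclideanSpace ℝ (Fin m)) (hx0 : x0 ∈ U)
    (ε0 : ℝ) (hε0 : 0 < ε0)
    (Υ : EuclideanSpace ℝ (Fin m) → ℝ → EuclideanSpace ℝ (Fin m))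
    (DΥ : EuclideanSpace ℝ (Fin m) → ℝ →
      (EuclideanSpace ℝ (Fin m) →L[ℝ] EuclideanSpace ℝ (Fin m)))
    (hdiff : ∀ ε ∈ Set.Ioo (0 : ℝ) ε0, ∀ x ∈ U,
      HasFDerivAt (fun y => Υ y ε) (DΥ x ε) x)
    (hcont : ∀ ε ∈ Set.Ioo (0 : ℝ) ε0, ContinuousOn (fun x => DΥ x ε) U)
    (r α : ℝ) (hα : 0 ≤ α) (hαr : 2 * α < r)
    (C1 C2 C3 : ℝ) (hC1 : 0 < C1) (hC2 : 0 < C2) (hC3 : 0 < C3)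
    (h1 : ∀ ε ∈ Set.Ioo (0 : ℝ) ε0, ‖Υ x0 ε‖ ≤ C1 * ε ^ r)
    (hinv : ∀ ε ∈ Set.Ioo (0 : ℝ) ε0,
      ∃ G : EuclideanSpace ℝ (Fin m) →L[ℝ] EuclideanSpace ℝ (Fin m),
        (∀ v, DΥ x0 ε (G v) = v) ∧ (∀ v, G (DΥ x0 ε v) = v) ∧
          ‖G‖ ≤ C2 * ε ^ (-α))
    (hlip : ∀ ε ∈ Set.Ioo (0 : ℝ) ε0, ∀ z ∈ U,
      ‖DΥ z ε - DΥ x0 ε‖ ≤ C3 * ‖z - x0‖) :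
    ∃ C0 > (0 : ℝ), ∃ εstar : ℝ, 0 < εstar ∧ εstar ≤ ε0 ∧
      ∀ ε : ℝ, 0 < ε → ε < εstar →
        ∃! x : EuclideanSpace ℝ (Fin m),
          x ∈ Metric.closedBall x0 (C0 * ε ^ (r - α)) ∧ Υ x ε = 0 := by
  have hr1 : 0 < r - α := by linarith
  have hr2 : 0 < r - 2 * α := by linarith
  obtain ⟨δ, hδ, hball⟩ := Metric.nhds_basis_closedBall.mem_iff.1 (hU.mem_nhds hx0)
  have hlim : ∀ p : ℝ, 0 < p → ∀ K : ℝ,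
      Filter.Tendsto (fun ε : ℝ => K * ε ^ p) (nhds 0) (nhds 0) := by
    intro p hp K
    have h := ((Real.continuousAt_rpow_const 0 p (Or.inr hp.le)).tendsto).const_mul K
    simpa [Real.zero_rpow hp.ne'] using h
  have e1 := (hlim _ hr1 (2 * C1 * C2)).eventually (ge_mem_nhds hδ)
  have e2 := (hlim _ hr2 (C3 * (2 * C1 * C2) * C2)).eventually
    (ge_mem_nhds (show (0 : ℝ) < 1 / 2 by norm_num))
  obtain ⟨η, hη, hηb⟩ := Metric.eventually_nhds_iff.1 (e1.and e2)
  refine ⟨2 * C1 * C2, by positivity, min η ε0, lt_min hη hε0, min_le_right _ _, ?_⟩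
  intro ε hε hεs
  have hεη : ε < η := lt_of_lt_of_le hεs (min_le_left _ _)
  have hmem : ε ∈ Set.Ioo (0 : ℝ) ε0 := ⟨hε, lt_of_lt_of_le hεs (min_le_right _ _)⟩
  obtain ⟨b1, b2⟩ := hηb (y := ε) (by simpa [abs_of_pos hε] using hεη)
  obtain ⟨G, hG1, hG2, hGn⟩ := hinv ε hmem
  have hA : 0 < ε ^ (-α) := Real.rpow_pos_of_pos hε _
  have hB : 0 < ε ^ (r - α) := Real.rpow_pos_of_pos hε _
  have hAB : ε ^ (-α) * ε ^ (r - α) = ε ^ (r - 2 * α) := by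
    rw [← Real.rpow_add hε]; congr 1; ring
  have hBr : ε ^ r * ε ^ (-α) = ε ^ (r - α) := by
    rw [← Real.rpow_add hε]; congr 1
  have hR : 0 < ε ^ r := Real.rpow_pos_of_pos hε _
  set ρ : ℝ := 2 * C1 * C2 * ε ^ (r - α) with hρ
  set N : ℝ := C2 * ε ^ (-α) with hN
  have hNpos : 0 < N := by positivity
  have hρpos : 0 < ρ := by positivity
  have hcN : C3 * ρ * N ≤ 1 / 2 := by
    refine le_trans (le_of_eq ?_) b2
    rw [hρ, hN, ← hAB]; ring
  have hρN : ρ = 2 * C1 * ε ^ r * N := by rw [hρ, hN, ← hBr]; ring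
  have hsub : Metric.closedBall x0 ρ ⊆ U :=
    (Metric.closedBall_subset_closedBall b1).trans hball
  have happ0 : ∀ x ∈ Metric.closedBall x0 ρ, ∀ y ∈ Metric.closedBall x0 ρ,
      ‖Υ x ε - Υ y ε - DΥ x0 ε (x - y)‖ ≤ C3 * ρ * ‖x - y‖ := by
    intro x hx y hy
    have hd : ∀ z ∈ Metric.closedBall x0 ρ,
        HasFDerivWithinAt (fun y => Υ y ε) (DΥ z ε) (Metric.closedBall x0 ρ) z :=
      fun z hz => (hdiff ε hmem z (hsub hz)).hasFDerivWithinAt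
    have hb : ∀ z ∈ Metric.closedBall x0 ρ, ‖DΥ z ε - DΥ x0 ε‖ ≤ C3 * ρ := by
      intro z hz
      refine (hlip ε hmem z (hsub hz)).trans ?_
      have : ‖z - x0‖ ≤ ρ := by rw [← dist_eq_norm]; exact hz
      exact mul_le_mul_of_nonneg_left this hC3.le
    exact Convex.norm_image_sub_le_of_norm_hasFDerivWithin_le' (f := fun y => Υ y ε)
      (f' := fun z => DΥ z ε) (φ := DΥ x0 ε) hd hb (convex_closedBall x0 ρ) hy hx
  have happ : ApproximatesLinearOn (fun y => Υ y ε) (DΥ x0 ε) (Metric.closedBall x0 ρ)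
      (⟨C3 * ρ, by positivity⟩ : NNReal) := by
    intro x hx y hy
    exact happ0 x hx y hy
  have hGb : ∀ v, ‖G v‖ ≤ N * ‖v‖ := fun v => G.le_of_opNorm_le hGn v
  let R : (DΥ x0 ε).NonlinearRightInverse :=
    { toFun := G
      nnnorm := ⟨N, hNpos.le⟩
      bound' := hGb
      right_inv' := hG1 }
  have hsurj := happ.surjOn_closedBall_of_nonlinearRightInverse R hρpos.le subset_rfl
  have h0 : (0 : EuclideanSpace ℝ (Fin m)) ∈
      Metric.closedBall (Υ x0 ε) ((N⁻¹ - C3 * ρ) * ρ) := by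
    rw [Metric.mem_closedBall, dist_zero_left]
    refine (h1 ε hmem).trans ?_
    have e : (N⁻¹ - C3 * ρ) * ρ = (1 - C3 * ρ * N) * (2 * C1 * ε ^ r) := by
      have : N⁻¹ - C3 * ρ = (1 - C3 * ρ * N) * N⁻¹ := by field_simp
      rw [this, mul_assoc]
      congr 1
      rw [hρN]; field_simp
    rw [e]
    have : 0 < C1 * ε ^ r := by positivity
    nlinarith
  obtain ⟨x, hx, hx'⟩ := hsurj h0
  refine ⟨x, ⟨hx, hx'⟩, ?_⟩
  rintro y ⟨hy, hy'⟩
  have key := happ y hy x hx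
  have hx2 : Υ x ε = 0 := hx'
  simp only [hx2, hy', sub_zero, zero_sub, norm_neg] at key
  have k1 := hGb (DΥ x0 ε (y - x))
  rw [hG2] at k1
  have k2 : ‖DΥ x0 ε (y - x)‖ ≤ C3 * ρ * ‖y - x‖ := key
  have k3 : ‖y - x‖ ≤ (C3 * ρ * N) * ‖y - x‖ := by
    calc _ ≤ _ := k1
      _ ≤ N * (C3 * ρ * ‖y - x‖) := by gcongr
      _ = _ := by ring
  have k4 : ‖y - x‖ ≤ 0 := by nlinarith [norm_nonneg (y - x)]
  exact sub_eq_zero.1 (norm_le_zero_iff.1 k4)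
end

section
/- Define doubly-indexed sequences of natural numbers ν_{r,s} and ν^{(I)}_{r,s} by: ν_{0,s} = 1 for all s ≥ 0; for r ≥ 1 and s ≥ 0, ν^{(I)}_{r,s} = ∑_{j=0}^{⌊s/r⌋} (ν_{r−1,r})^j · ν_{r−1, s−jr}, and ν_{r,s} = ∑_{j=0}^{⌊s/r⌋} (3 ν_{r−1,r})^j · ν^{(I)}_{r, s−jr}. Then for all integers r ≥ 0 and s ≥ 1 one has ν_{r,s} ≤ ν_{s,s} ≤ 100^s / 20. -/
/-- The sequence `ν_{r,s}` counting the number of terms generated at step `r`,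
order `s` of the normal form algorithm:
`ν_{0,s} = 1` and, for `r ≥ 1`,
`ν_{r,s} = ∑_{j=0}^{⌊s/r⌋} (3 ν_{r-1,r})^j · ν^{(I)}_{r, s-jr}` where
`ν^{(I)}_{r,s} = ∑_{j=0}^{⌊s/r⌋} (ν_{r-1,r})^j · ν_{r-1, s-jr}`
(the inner sum below is exactly `ν^{(I)}_{r, s-j(r)}`). -/
def nu : ℕ → ℕ → ℕ
  | 0, _ => 1
  | r + 1, s =>
      ∑ j ∈ Finset.range (s / (r + 1) + 1),
        (3 * nu r (r + 1)) ^ j *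
          (∑ i ∈ Finset.range ((s - j * (r + 1)) / (r + 1) + 1),
            (nu r (r + 1)) ^ i * nu r ((s - j * (r + 1)) - i * (r + 1)))

/-- The auxiliary sequence `ν^{(I)}_{r,s}` (for `r ≥ 1`):
`ν^{(I)}_{r,s} = ∑_{j=0}^{⌊s/r⌋} (ν_{r-1,r})^j · ν_{r-1, s-jr}`. -/
def nuI : ℕ → ℕ → ℕ
  | 0, _ => 1
  | r + 1, s =>
      ∑ j ∈ Finset.range (s / (r + 1) + 1),
        (nu r (r + 1)) ^ j * nu r (s - j * (r + 1))

/-- Geometric-type sums satisfy a one-step recurrence. -/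
lemma geo_step (f : ℕ → ℕ) (c q s : ℕ) (hq : 0 < q) :
    ∑ j ∈ Finset.range ((s + q) / q + 1), c ^ j * f (s + q - j * q)
      = f (s + q) + c * ∑ j ∈ Finset.range (s / q + 1), c ^ j * f (s - j * q) := by
  rw [Nat.add_div_right s hq, Finset.sum_range_succ', Finset.mul_sum, add_comm]
  congr 1
  · simp
  · apply Finset.sum_congr rfl
    intro j _
    have : s + q - (j + 1) * q = s - j * q := by
      rw [Nat.add_mul, one_mul, Nat.add_sub_add_right]
    rw [this]; ring

lemma nu_succ_eq (r s : ℕ) : nu (r + 1) s =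
    ∑ j ∈ Finset.range (s / (r + 1) + 1),
      (3 * nu r (r + 1)) ^ j * nuI (r + 1) (s - j * (r + 1)) := by
  simp only [nu, nuI]

lemma nu_lt (r s : ℕ) (h : s < r + 1) : nu (r + 1) s = nu r s := by
  rw [nu_succ_eq, Nat.div_eq_of_lt h]
  simp [nuI, Nat.div_eq_of_lt h]

lemma nuI_step (r s : ℕ) : nuI (r + 1) (s + (r + 1)) =
    nu r (s + (r + 1)) + nu r (r + 1) * nuI (r + 1) s := by
  simp only [nuI]
  exact geo_step (nu r) _ _ _ (Nat.succ_pos r)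

lemma nu_step (r s : ℕ) : nu (r + 1) (s + (r + 1)) =
    nuI (r + 1) (s + (r + 1)) + 3 * nu r (r + 1) * nu (r + 1) s := by
  rw [nu_succ_eq, nu_succ_eq r s]
  exact geo_step (nuI (r + 1)) _ _ _ (Nat.succ_pos r)

lemma nuI_le (r s : ℕ) : nuI (r + 1) s ≤ nu (r + 1) s := by
  rw [nu_succ_eq, Finset.sum_range_succ']
  simp

lemma nu_step_le (r s : ℕ) : nu (r + 1) (s + (r + 1)) ≤
    nu r (s + (r + 1)) + 4 * nu r (r + 1) * nu (r + 1) s := by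
  rw [nu_step, nuI_step]
  have := Nat.mul_le_mul_left (nu r (r + 1)) (nuI_le r s)
  nlinarith

lemma nu_mono_step (r s : ℕ) : nu r s ≤ nu (r + 1) s := by
  rcases lt_or_ge s (r + 1) with h | h
  · rw [nu_lt r s h]
  · obtain ⟨t, rfl⟩ := Nat.exists_eq_add_of_le' h
    rw [nu_step, nuI_step]
    omega

lemma nu_mono (s : ℕ) : Monotone (fun r => nu r s) :=
  monotone_nat_of_le_succ (fun r => nu_mono_step r s)

lemma nu_const (s k : ℕ) : nu (s + k) s = nu s s := by
  induction k with
  | zero => rfl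
  | succ k ih => rw [← add_assoc, nu_lt _ _ (by omega), ih]

lemma nu_le_diag (r s : ℕ) : nu r s ≤ nu s s := by
  rcases le_total r s with h | h
  · exact nu_mono s h
  · obtain ⟨k, rfl⟩ := Nat.exists_eq_add_of_le h
    rw [nu_const]

lemma nu_zero (r : ℕ) : nu r 0 = 1 := by
  induction r with
  | zero => simp [nu]
  | succ r ih => rw [nu_lt _ _ (by omega), ih]

lemma nu_diag_le (n : ℕ) : nu (n + 1) (n + 1) ≤ 5 * nu n (n + 1) := by
  have := nu_step_le n 0
  rw [nu_zero, zero_add] at this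
  omega

lemma nu_sum_le (n m : ℕ) (hm : m ≤ n + 1) : nu m (n + 2) ≤
    1 + 20 * ∑ k ∈ Finset.range m, nu k (k + 1) * nu (n - k) (n - k + 1) := by
  induction m with
  | zero => simp [nu]
  | succ m ih =>
    have h1 := ih (by omega)
    have h2 := nu_step_le m (n - m + 1)
    rw [show n - m + 1 + (m + 1) = n + 2 by omega] at h2
    have h3 := (nu_le_diag (m + 1) (n - m + 1)).trans (nu_diag_le (n - m))
    have h4 := Nat.mul_le_mul_left (4 * nu m (m + 1)) h3
    rw [Finset.sum_range_succ]
    nlinarith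

lemma nu_catalan (n : ℕ) : nu n (n + 1) ≤ 25 ^ n * catalan n := by
  induction n using Nat.strong_induction_on with
  | _ n ih =>
    rcases n with _ | n
    · simp [nu]
    · have h := nu_sum_le n (n + 1) le_rfl
      have h2 : ∑ k ∈ Finset.range (n + 1), nu k (k + 1) * nu (n - k) (n - k + 1)
          ≤ 25 ^ n * catalan (n + 1) := by
        rw [catalan_succ, Finset.sum_range fun k => nu k (k + 1) * nu (n - k) (n - k + 1),
          Finset.mul_sum]
        apply Finset.sum_le_sum
        intro k _
        have hk := k.2
        calc _ ≤ (25 ^ (k : ℕ) * catalan k) * (25 ^ (n - k) * catalan (n - k)) :=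
              Nat.mul_le_mul (ih _ hk) (ih _ (by omega))
          _ = 25 ^ ((k : ℕ) + (n - k)) * (catalan k * catalan (n - k)) := by
              rw [pow_add]; ring
          _ = _ := by rw [show (k : ℕ) + (n - k) = n by omega]
      have h3 : 0 < 25 ^ n * catalan (n + 1) := by
        apply Nat.mul_pos (by positivity)
        have := succ_mul_catalan_eq_centralBinom (n + 1)
        have h5 := Nat.centralBinom_pos (n + 1)
        rw [← this] at h5
        exact Nat.pos_of_mul_pos_left h5
      have h4 : 25 ^ (n + 1) * catalan (n + 1) = 25 * (25 ^ n * catalan (n + 1)) := by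
        rw [pow_succ]; ring
      rw [h4]
      show nu (n + 1) (n + 2) ≤ _
      omega

lemma catalan_le_pow (n : ℕ) : catalan n ≤ 4 ^ n := by
  rw [catalan_eq_centralBinom_div]
  refine (Nat.div_le_self _ _).trans ?_
  rw [Nat.centralBinom, show 4 = 2 ^ 2 by rfl, ← pow_mul]
  exact Nat.choose_le_two_pow _ _

/-- For all `r ≥ 0` and `s ≥ 1`, one has `ν_{r,s} ≤ ν_{s,s} ≤ 100^s / 20`. -/
theorem nu_le_diag_le (r s : ℕ) (hs : 1 ≤ s) :
    nu r s ≤ nu s s ∧ (nu s s : ℚ) ≤ 100 ^ s / 20 := by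
  refine ⟨nu_le_diag r s, ?_⟩
  obtain ⟨n, rfl⟩ := Nat.exists_eq_add_of_le' hs
  have h1 : nu n (n + 1) ≤ 100 ^ n :=
    calc _ ≤ 25 ^ n * 4 ^ n := (nu_catalan n).trans (Nat.mul_le_mul_left _ (catalan_le_pow n))
      _ = 100 ^ n := by rw [← mul_pow]; norm_num
  have h2 : nu (n + 1) (n + 1) ≤ 5 * 100 ^ n := (nu_diag_le n).trans (by omega)
  have h3 : (nu (n + 1) (n + 1) : ℚ) ≤ 5 * 100 ^ n := by exact_mod_cast h2
  rw [pow_succ]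
  linarith
end

section
/- Define doubly-indexed sequences of natural numbers ν_{r,s} and ν^{(I)}_{r,s} by: ν_{0,s} = 1 for all s ≥ 0; for r ≥ 1 and s ≥ 0, ν^{(I)}_{r,s} = ∑_{j=0}^{⌊s/r⌋} (ν_{r−1,r})^j · ν_{r−1, s−jr}, and ν_{r,s} = ∑_{j=0}^{⌊s/r⌋} (3 ν_{r−1,r})^j · ν^{(I)}_{r, s−jr}. Then for every r ≥ 1 and s ≥ 0, the two-step recursion collapses to the single-step recursion ν_{r,s} = ∑_{j=0}^{⌊s/r⌋} θ_j · (ν_{r−1,r})^j · ν_{r−1, s−jr}, where θ_j = (3^{j+1} − 1)/2. -/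
/-- For `r ≥ 1` and `s ≥ 0`, the two-step recursion defining `ν_{r,s}` collapses to
the single-step recursion `ν_{r,s} = ∑_{j=0}^{⌊s/r⌋} θ_j (ν_{r-1,r})^j ν_{r-1,s-jr}`
with `θ_j = (3^{j+1} - 1)/2`. -/
theorem nu_single_step_recursion (r s : ℕ) (hr : 1 ≤ r) :
    nu r s = ∑ j ∈ Finset.range (s / r + 1),
      ((3 ^ (j + 1) - 1) / 2) * (nu (r - 1) r) ^ j * nu (r - 1) (s - j * r) := by
  obtain ⟨r, rfl⟩ : ∃ q, r = q + 1 := ⟨r - 1, by omega⟩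
  simp only [Nat.add_sub_cancel]
  rw [nu]
  generalize nu r (r + 1) = a
  have h1 : ∀ j ∈ Finset.range (s / (r + 1) + 1),
      (3 * a) ^ j * (∑ i ∈ Finset.range ((s - j * (r + 1)) / (r + 1) + 1),
        a ^ i * nu r ((s - j * (r + 1)) - i * (r + 1)))
      = ∑ i ∈ Finset.range (s / (r + 1) + 1 - j),
        3 ^ j * a ^ (j + i) * nu r (s - (j + i) * (r + 1)) := by
    intro j hj
    have hj' := Finset.mem_range.mp hj
    have e : (s - j * (r + 1)) / (r + 1) + 1 = s / (r + 1) + 1 - j := by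
      rw [mul_comm j, Nat.sub_mul_div]
      omega
    rw [e, Finset.mul_sum]
    refine Finset.sum_congr rfl fun i _ => ?_
    rw [Nat.sub_sub, ← add_mul, mul_pow, pow_add]
    ring
  rw [Finset.sum_congr rfl h1, ← Finset.sum_range_diag_flip (s / (r + 1) + 1)
    (fun j i => 3 ^ j * a ^ (j + i) * nu r (s - (j + i) * (r + 1)))]
  refine Finset.sum_congr rfl fun k _ => ?_
  have h2 := Nat.geomSum_eq (m := 3) (by norm_num) (k + 1)
  norm_num at h2
  rw [← h2, mul_assoc, Finset.sum_mul]
  refine Finset.sum_congr rfl fun j hj => ?_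
  have hj' := Finset.mem_range.mp hj
  rw [Nat.add_sub_cancel' (by omega : j ≤ k), mul_assoc]
end

section
/- Let n ≥ 1 and l ≥ 1 be integers, ρ > 0, σ > 0, and 0 < d < 1. Let g_{i,k} ∈ ℂ be a family of coefficients indexed by multi-indices i ∈ ℕ^n with |i| = i_1 + ⋯ + i_n = l and lattice vectors k ∈ ℤ^n, such that the weighted sum ‖g‖_1 := ∑_{|i|=l} ∑_{k ∈ ℤ^n} |g_{i,k}| ρ^l e^{|k|σ} is finite, where |k| = |k_1| + ⋯ + |k_n|. Then for every index j ∈ {1,…,n}, ∑_{|i|=l} ∑_{k ∈ ℤ^n} i_j |g_{i,k}| ((1−d)ρ)^{l−1} e^{|k|(1−d)σ} ≤ ‖g‖_1 / (dρ). -/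
/-- The elementary inequality behind the Cauchy estimate. -/
lemma cauchy_aux (d : ℝ) (hd0 : 0 < d) (hd1 : d < 1) (m : ℕ) :
    ((m : ℝ) + 1) * d * (1 - d) ^ m + (1 - d) ^ (m + 1) ≤ 1 := by
  induction m with
  | zero => simp
  | succ m ih =>
    have hx : 0 ≤ 1 - d := by linarith
    have h1 := mul_le_mul_of_nonneg_left ih hx
    have h2 : d * (1 - d) ^ (m + 1) ≤ d * 1 :=
      mul_le_mul_of_nonneg_left (pow_le_one₀ hx (by linarith)) hd0.le
    have h3 : (((m + 1 : ℕ) : ℝ) + 1) * d * (1 - d) ^ (m + 1) + (1 - d) ^ (m + 1 + 1)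
        = (1 - d) * (((m : ℝ) + 1) * d * (1 - d) ^ m + (1 - d) ^ (m + 1))
          + d * (1 - d) ^ (m + 1) := by
      push_cast
      ring
    rw [h3]
    linarith

/-- Cauchy estimate for the action-derivative `∂g/∂p_j` of a Fourier–Taylor series
`g(p,q) = ∑_{|i|=l} ∑_k g_{i,k} p^i e^{i⟨k,q⟩}` in the weighted Fourier norm:
if `‖g‖₁ = ∑_{|i|=l} ∑_k |g_{i,k}| ρ^l e^{|k|σ}` is finite, then for each `j`,
`∑_{|i|=l} ∑_k i_j |g_{i,k}| ((1-d)ρ)^{l-1} e^{|k|(1-d)σ} ≤ ‖g‖₁/(dρ)`. -/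
theorem cauchy_estimate_action_derivative
    (n l : ℕ) (hn : 1 ≤ n) (hl : 1 ≤ l)
    (ρ σ d : ℝ) (hρ : 0 < ρ) (hσ : 0 < σ) (hd0 : 0 < d) (hd1 : d < 1)
    (g : (Fin n → ℕ) → (Fin n → ℤ) → ℂ)
    (hsupp : ∀ (i : Fin n → ℕ) (k : Fin n → ℤ), (∑ j, i j) ≠ l → g i k = 0)
    (hfin : (∑' (i : Fin n → ℕ) (k : Fin n → ℤ),
        ENNReal.ofReal (‖g i k‖ * ρ ^ l * Real.exp ((∑ j, |(k j : ℝ)|) * σ))) ≠ ⊤)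
    (j : Fin n) :
    (∑' (i : Fin n → ℕ) (k : Fin n → ℤ),
        ENNReal.ofReal ((i j : ℝ) * ‖g i k‖ * ((1 - d) * ρ) ^ (l - 1) *
          Real.exp ((∑ j', |(k j' : ℝ)|) * ((1 - d) * σ))))
      ≤ (∑' (i : Fin n → ℕ) (k : Fin n → ℤ),
          ENNReal.ofReal (‖g i k‖ * ρ ^ l * Real.exp ((∑ j', |(k j' : ℝ)|) * σ)))
        / ENNReal.ofReal (d * ρ) := by
  have hdρ : 0 < d * ρ := mul_pos hd0 hρ
  have hx : 0 ≤ 1 - d := by linarith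
  rw [ENNReal.div_eq_inv_mul, ← ENNReal.tsum_mul_left]
  refine ENNReal.tsum_le_tsum fun i => ?_
  rw [← ENNReal.tsum_mul_left]
  refine ENNReal.tsum_le_tsum fun k => ?_
  rw [← ENNReal.ofReal_inv_of_pos hdρ, ← ENNReal.ofReal_mul (inv_nonneg.2 hdρ.le)]
  apply ENNReal.ofReal_le_ofReal
  by_cases h : (∑ j, i j) = l
  swap
  · simp [hsupp i k h]
  have hij : i j ≤ l := h ▸ Finset.single_le_sum (fun _ _ => Nat.zero_le _) (Finset.mem_univ j)
  obtain ⟨m, rfl⟩ : ∃ m, l = m + 1 := ⟨l - 1, by omega⟩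
  have hijR : (i j : ℝ) ≤ (m : ℝ) + 1 := by exact_mod_cast hij
  have hS : 0 ≤ ∑ j', |(k j' : ℝ)| := Finset.sum_nonneg fun _ _ => abs_nonneg _
  have hexp : Real.exp ((∑ j', |(k j' : ℝ)|) * ((1 - d) * σ))
      ≤ Real.exp ((∑ j', |(k j' : ℝ)|) * σ) := by
    apply Real.exp_le_exp.2
    apply mul_le_mul_of_nonneg_left _ hS
    nlinarith
  have hcoef : d * ((i j : ℝ) * (1 - d) ^ m) ≤ 1 := by
    have h1 := cauchy_aux d hd0 hd1 m
    have h2 : 0 ≤ (1 - d) ^ (m + 1) := pow_nonneg hx _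
    have h3 : (i j : ℝ) * (d * (1 - d) ^ m) ≤ ((m : ℝ) + 1) * (d * (1 - d) ^ m) :=
      mul_le_mul_of_nonneg_right hijR (mul_nonneg hd0.le (pow_nonneg hx _))
    linarith
  rw [Nat.add_sub_cancel, inv_mul_eq_div, le_div_iff₀ hdρ, mul_pow]
  calc _ = (d * ((i j : ℝ) * (1 - d) ^ m)) * (‖g i k‖ * ρ ^ (m + 1) *
          Real.exp ((∑ j', |(k j' : ℝ)|) * ((1 - d) * σ))) := by ring
    _ ≤ 1 * (‖g i k‖ * ρ ^ (m + 1) * Real.exp ((∑ j', |(k j' : ℝ)|) * σ)) := by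
        gcongr
    _ = _ := by ring
end

section
/- Let n ≥ 1 and l ≥ 0 be integers, ρ > 0, σ > 0, and 0 < d < 1. Let g_{i,k} ∈ ℂ be a family of coefficients indexed by multi-indices i ∈ ℕ^n with |i| = i_1 + ⋯ + i_n = l and lattice vectors k ∈ ℤ^n, such that the weighted sum ‖g‖_1 := ∑_{|i|=l} ∑_{k ∈ ℤ^n} |g_{i,k}| ρ^l e^{|k|σ} is finite, where |k| = |k_1| + ⋯ + |k_n|. Then for every index j ∈ {1,…,n}, ∑_{|i|=l} ∑_{k ∈ ℤ^n} |k_j| |g_{i,k}| ((1−d)ρ)^l e^{|k|(1−d)σ} ≤ ‖g‖_1 / (e·d·σ). -/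
/-- Cauchy estimate for the angle-derivative `∂g/∂q_j` of a Fourier–Taylor series
`g(p,q) = ∑_{|i|=l} ∑_k g_{i,k} p^i e^{i⟨k,q⟩}` in the weighted Fourier norm:
if `‖g‖₁ = ∑_{|i|=l} ∑_k |g_{i,k}| ρ^l e^{|k|σ}` is finite, then for each `j`,
`∑_{|i|=l} ∑_k |k_j| |g_{i,k}| ((1-d)ρ)^l e^{|k|(1-d)σ} ≤ ‖g‖₁/(e·d·σ)`. -/
theorem cauchy_estimate_angle_derivative
    (n l : ℕ) (hn : 1 ≤ n)
    (ρ σ d : ℝ) (hρ : 0 < ρ) (hσ : 0 < σ) (hd0 : 0 < d) (hd1 : d < 1)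
    (g : (Fin n → ℕ) → (Fin n → ℤ) → ℂ)
    (hsupp : ∀ (i : Fin n → ℕ) (k : Fin n → ℤ), (∑ j, i j) ≠ l → g i k = 0)
    (hfin : (∑' (i : Fin n → ℕ) (k : Fin n → ℤ),
        ENNReal.ofReal (‖g i k‖ * ρ ^ l * Real.exp ((∑ j, |(k j : ℝ)|) * σ))) ≠ ⊤)
    (j : Fin n) :
    (∑' (i : Fin n → ℕ) (k : Fin n → ℤ),
        ENNReal.ofReal (|(k j : ℝ)| * ‖g i k‖ * ((1 - d) * ρ) ^ l *
          Real.exp ((∑ j', |(k j' : ℝ)|) * ((1 - d) * σ))))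
      ≤ (∑' (i : Fin n → ℕ) (k : Fin n → ℤ),
          ENNReal.ofReal (‖g i k‖ * ρ ^ l * Real.exp ((∑ j', |(k j' : ℝ)|) * σ)))
        / ENNReal.ofReal (Real.exp 1 * d * σ) := by
  rw [div_eq_mul_inv, ← ENNReal.tsum_mul_right]
  refine ENNReal.tsum_le_tsum fun i => ?_
  rw [← ENNReal.tsum_mul_right]
  refine ENNReal.tsum_le_tsum fun k => ?_
  have hc : 0 < Real.exp 1 * d * σ := by positivity
  rw [← div_eq_mul_inv, ← ENNReal.ofReal_div_of_pos hc]
  apply ENNReal.ofReal_le_ofReal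
  rw [le_div_iff₀ hc]
  have hS : |(k j : ℝ)| ≤ ∑ j', |(k j' : ℝ)| :=
    Finset.single_le_sum (f := fun j' => |(k j' : ℝ)|) (fun _ _ => abs_nonneg _)
      (Finset.mem_univ j)
  generalize (∑ j', |(k j' : ℝ)|) = S at *
  have hx : 0 ≤ |(k j : ℝ)| := abs_nonneg _
  generalize |(k j : ℝ)| = x at *
  have hpow : ((1 - d) * ρ) ^ l ≤ ρ ^ l := by
    apply pow_le_pow_left₀
    · exact mul_nonneg (by linarith) hρ.le
    · nlinarith
  have hexp : Real.exp 1 * (d * σ * S) ≤ Real.exp (d * σ * S) := by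
    have h1 : d * σ * S ≤ Real.exp (d * σ * S - 1) := by
      have := Real.add_one_le_exp (d * σ * S - 1)
      linarith
    calc Real.exp 1 * (d * σ * S) ≤ Real.exp 1 * Real.exp (d * σ * S - 1) := by gcongr
      _ = Real.exp (d * σ * S) := by rw [← Real.exp_add]; congr 1; ring
  have hxS : Real.exp 1 * (d * σ * x) ≤ Real.exp (d * σ * S) :=
    le_trans (by gcongr) hexp
  calc x * ‖g i k‖ * ((1 - d) * ρ) ^ l * Real.exp (S * ((1 - d) * σ)) * (Real.exp 1 * d * σ)
      = ‖g i k‖ * ((1 - d) * ρ) ^ l *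
          (Real.exp (S * ((1 - d) * σ)) * (Real.exp 1 * (d * σ * x))) := by ring
    _ ≤ ‖g i k‖ * ρ ^ l * (Real.exp (S * ((1 - d) * σ)) * Real.exp (d * σ * S)) := by
        gcongr
    _ = ‖g i k‖ * ρ ^ l * Real.exp (S * σ) := by
        rw [← Real.exp_add]; congr 2; ring
end

section
/- Consider the system of equations on ℝ³: sin q2 + sin(q2+q3+q4) = 0, sin q3 + sin(q2+q3+q4) = 0, sin q4 + sin(q2+q3+q4) = 0. A triple (q2, q3, q4) ∈ ℝ³ solves this system if and only if, modulo 2π in each component, it belongs to the set {(0,0,0), (π,π,π)} ∪ {(θ, θ, π−θ) : θ ∈ ℝ} ∪ {(θ, π−θ, θ) : θ ∈ ℝ} ∪ {(θ, π−θ, π−θ) : θ ∈ ℝ}. -/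
open Real

/-- Classification of the critical points of the first-order averaged Hamiltonian
of the four-site dNLS cell: `(q₂,q₃,q₄)` solves the system
`sin q₂ + sin(q₂+q₃+q₄) = sin q₃ + sin(q₂+q₃+q₄) = sin q₄ + sin(q₂+q₃+q₄) = 0`
iff, modulo `2π` componentwise, it is `(0,0,0)`, `(π,π,π)`, or belongs to one of
the families `(θ,θ,π-θ)`, `(θ,π-θ,θ)`, `(θ,π-θ,π-θ)`. -/
theorem critical_points_classification (q2 q3 q4 : ℝ) :
    (Real.sin q2 + Real.sin (q2 + q3 + q4) = 0 ∧
     Real.sin q3 + Real.sin (q2 + q3 + q4) = 0 ∧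
     Real.sin q4 + Real.sin (q2 + q3 + q4) = 0) ↔
    (∃ a b c : ℤ,
      (q2 = 2 * π * a ∧ q3 = 2 * π * b ∧ q4 = 2 * π * c) ∨
      (q2 = π + 2 * π * a ∧ q3 = π + 2 * π * b ∧ q4 = π + 2 * π * c) ∨
      (∃ θ : ℝ, q2 = θ + 2 * π * a ∧ q3 = θ + 2 * π * b ∧
        q4 = π - θ + 2 * π * c) ∨
      (∃ θ : ℝ, q2 = θ + 2 * π * a ∧ q3 = π - θ + 2 * π * b ∧
        q4 = θ + 2 * π * c) ∨
      (∃ θ : ℝ, q2 = θ + 2 * π * a ∧ q3 = π - θ + 2 * π * b ∧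
        q4 = π - θ + 2 * π * c)) := by
  have per : ∀ (x y : ℝ) (n : ℤ), x = y + 2 * π * n → Real.sin x = Real.sin y := by
    intro x y n h
    rw [h, show y + 2 * π * n = y + n * (2 * π) by ring, Real.sin_add_int_mul_two_pi]
  constructor
  · rintro ⟨h2, h3, h4⟩
    have e3 : Real.sin q2 = Real.sin q3 := by linarith
    have e4 : Real.sin q2 = Real.sin q4 := by linarith
    obtain ⟨k, hk | hk⟩ := Real.sin_eq_sin_iff.1 e3 <;>
      obtain ⟨m, hm | hm⟩ := Real.sin_eq_sin_iff.1 e4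
    · have hs := per (q2 + q3 + q4) (3 * q2) (k + m) (by rw [hk, hm]; push_cast; ring)
      rw [hs, Real.sin_three_mul] at h2
      have hf : Real.sin q2 * (Real.cos q2 * Real.cos q2) = 0 := by
        have := Real.sin_sq_add_cos_sq q2
        linear_combination h2 / 4 + Real.sin q2 * this
      rcases mul_eq_zero.1 hf with h0 | h0
      · obtain ⟨n, hn⟩ := Real.sin_eq_zero_iff.1 h0
        obtain ⟨j, hj | hj⟩ := Int.even_or_odd' n
        · refine ⟨j, j + k, j + m, Or.inl ?_⟩
          subst hj
          push_cast at hn ⊢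
          refine ⟨by linarith, by linarith, by linarith⟩
        · refine ⟨j, j + k, j + m, Or.inr (Or.inl ?_)⟩
          subst hj
          push_cast at hn ⊢
          refine ⟨by linarith, by linarith, by linarith⟩
      · obtain ⟨n, hn⟩ := Real.cos_eq_zero_iff.1 (mul_self_eq_zero.1 h0)
        refine ⟨0, k, m + n, Or.inr (Or.inr (Or.inl ⟨q2, ?_⟩))⟩
        push_cast
        refine ⟨by linarith, by linarith, by linarith⟩
    · refine ⟨0, k, m, Or.inr (Or.inr (Or.inl ⟨q2, ?_⟩))⟩
      push_cast
      refine ⟨by linarith, by linarith, by linarith⟩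
    · refine ⟨0, k, m, Or.inr (Or.inr (Or.inr (Or.inl ⟨q2, ?_⟩)))⟩
      push_cast
      refine ⟨by linarith, by linarith, by linarith⟩
    · refine ⟨0, k, m, Or.inr (Or.inr (Or.inr (Or.inr ⟨q2, ?_⟩)))⟩
      push_cast
      refine ⟨by linarith, by linarith, by linarith⟩
  · rintro ⟨a, b, c, ⟨h2, h3, h4⟩ | ⟨h2, h3, h4⟩ | ⟨θ, h2, h3, h4⟩ | ⟨θ, h2, h3, h4⟩ |
      ⟨θ, h2, h3, h4⟩⟩
    · rw [per q2 0 a (by linarith), per q3 0 b (by linarith), per q4 0 c (by linarith),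
        per (q2 + q3 + q4) 0 (a + b + c) (by push_cast; linarith)]
      simp
    · rw [per q2 π a h2, per q3 π b h3, per q4 π c h4,
        per (q2 + q3 + q4) π (a + b + c + 1) (by push_cast; linarith)]
      simp
    · rw [per q2 _ a h2, per q3 _ b h3, per q4 _ c h4,
        per (q2 + q3 + q4) (θ + π) (a + b + c) (by push_cast; linarith)]
      simp [Real.sin_pi_sub, Real.sin_add_pi]
    · rw [per q2 _ a h2, per q3 _ b h3, per q4 _ c h4,
        per (q2 + q3 + q4) (θ + π) (a + b + c) (by push_cast; linarith)]
      simp [Real.sin_pi_sub, Real.sin_add_pi]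
    · rw [per q2 _ a h2, per q3 _ b h3, per q4 _ c h4,
        per (q2 + q3 + q4) (-θ) (a + b + c + 1) (by push_cast; linarith)]
      simp [Real.sin_pi_sub]
end

section
/- Define G1, G2, G3 : ℝ³ → ℝ by G1(q2,q3,q4) = 2 sin(2q2) + sin(q2−q3) + 2 sin(q2+q3) + 2 sin(2q2+2q3+2q4) + 2 sin(2q2+q3+q4) + sin(q2+q3+2q4); G2(q2,q3,q4) = 2 sin(2q3) + sin(q3−q2) + 2 sin(q2+q3) + sin(q3−q4) + 2 sin(q3+q4) + 2 sin(2q2+2q3+2q4) + sin(2q2+q3+q4) + sin(q2+q3+2q4); G3(q2,q3,q4) = 2 sin(2q4) + sin(q4−q3) + 2 sin(q3+q4) + 2 sin(2q2+2q3+2q4) + sin(2q2+q3+q4) + 2 sin(q2+q3+2q4). Then for every θ ∈ ℝ: G1(θ,θ,π−θ) + G2(θ,θ,π−θ) − G3(θ,θ,π−θ) = 8 sin(2θ), and likewise G1(θ,π−θ,π−θ) − G2(θ,π−θ,π−θ) − G3(θ,π−θ,π−θ) = 8 sin(2θ). -/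
open Real

/-- First component of the second-order correction to the gradient system. -/
noncomputable def G1 (q2 q3 q4 : ℝ) : ℝ :=
  2 * sin (2 * q2) + sin (q2 - q3) + 2 * sin (q2 + q3) +
    2 * sin (2 * q2 + 2 * q3 + 2 * q4) + 2 * sin (2 * q2 + q3 + q4) +
    sin (q2 + q3 + 2 * q4)

/-- Second component of the second-order correction to the gradient system. -/
noncomputable def G2 (q2 q3 q4 : ℝ) : ℝ :=
  2 * sin (2 * q3) + sin (q3 - q2) + 2 * sin (q2 + q3) + sin (q3 - q4) +
    2 * sin (q3 + q4) + 2 * sin (2 * q2 + 2 * q3 + 2 * q4) +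
    sin (2 * q2 + q3 + q4) + sin (q2 + q3 + 2 * q4)

/-- Third component of the second-order correction to the gradient system. -/
noncomputable def G3 (q2 q3 q4 : ℝ) : ℝ :=
  2 * sin (2 * q4) + sin (q4 - q3) + 2 * sin (q3 + q4) +
    2 * sin (2 * q2 + 2 * q3 + 2 * q4) + sin (2 * q2 + q3 + q4) +
    2 * sin (q2 + q3 + 2 * q4)

/-- Breaking of the one-parameter families `Q₁(θ) = (θ,θ,π-θ)` and
`Q₃(θ) = (θ,π-θ,π-θ)`: the projections of the second-order correction
`(G₁,G₂,G₃)` along the tangent directions `(1,1,-1)` and `(1,-1,-1)`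
both equal `8 sin(2θ)`. -/
theorem families_breaking (θ : ℝ) :
    G1 θ θ (π - θ) + G2 θ θ (π - θ) - G3 θ θ (π - θ) = 8 * sin (2 * θ) ∧
    G1 θ (π - θ) (π - θ) - G2 θ (π - θ) (π - θ) - G3 θ (π - θ) (π - θ)
      = 8 * sin (2 * θ) := by
  have e1 : sin (2 * θ + π) = -sin (2 * θ) := sin_add_pi _
  have e2 : sin (2 * θ - π) = -sin (2 * θ) := sin_sub_pi _
  have e3 : sin (π - 2 * θ) = sin (2 * θ) := sin_pi_sub _
  have e4 : sin (2 * π - 2 * θ) = -sin (2 * θ) := sin_two_pi_sub _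
  have e5 : sin (2 * θ + 2 * π) = sin (2 * θ) := sin_add_two_pi _
  have e6 : sin (4 * π - 2 * θ) = -sin (2 * θ) := by
    rw [show 4 * π - 2 * θ = (2 * π - 2 * θ) + 2 * π by ring, sin_add_two_pi, e4]
  have e7 : sin (3 * π - 2 * θ) = sin (2 * θ) := by
    rw [show 3 * π - 2 * θ = (π - 2 * θ) + 2 * π by ring, sin_add_two_pi, e3]
  unfold G1 G2 G3
  constructor
  · rw [show θ - θ = 0 by ring, show θ + θ = 2 * θ by ring,
      show 2 * θ + 2 * θ + 2 * (π - θ) = 2 * θ + 2 * π by ring,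
      show 2 * θ + θ + (π - θ) = 2 * θ + π by ring,
      show 2 * θ + 2 * (π - θ) = 2 * π by ring,
      show θ - (π - θ) = 2 * θ - π by ring,
      show θ + (π - θ) = π by ring,
      show 2 * (π - θ) = 2 * π - 2 * θ by ring,
      show π - θ - θ = π - 2 * θ by ring,
      e1, e2, e3, e4, e5, sin_two_pi, sin_pi, sin_zero]
    ring
  · rw [show θ - (π - θ) = 2 * θ - π by ring,
      show θ + (π - θ) + 2 * (π - θ) = 3 * π - 2 * θ by ring,
      show θ + (π - θ) = π by ring,
      show 2 * θ + 2 * (π - θ) + 2 * (π - θ) = 4 * π - 2 * θ by ring,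
      show 2 * θ + (π - θ) + (π - θ) = 2 * π by ring,
      show π - θ - (π - θ) = 0 by ring,
      show π - θ + (π - θ) = 2 * π - 2 * θ by ring,
      show 2 * (π - θ) = 2 * π - 2 * θ by ring,
      show π - θ - θ = π - 2 * θ by ring,
      e2, e3, e4, e6, e7, sin_two_pi, sin_pi, sin_zero]
    ring
end

section
/- Let a > 0, θ, φ1 ∈ ℝ, and ε ∈ ℝ be arbitrary. Set ω = 1 + 2a², define the phases φ = (φ1, φ1 + θ, φ1 + π, φ1 + θ + π), and define ψ_j : ℝ → ℂ by ψ_j(t) = a · exp(i(φ_j − ω t)) for j ∈ {1,2,3,4}. Then ψ solves the discrete nonlinear Schrödinger system i (dψ_j/dt)(t) = ψ_j(t) + 2 |ψ_j(t)|² ψ_j(t) + ε (ψ_{j+1}(t) + ψ_{j−1}(t)) for all t ∈ ℝ and all j, where the indices are taken cyclically modulo 4 (ψ_0 = ψ_4, ψ_5 = ψ_1). -/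
/-- The one-parameter family `Q₂` of phase configurations gives exact periodic
solutions of the four-site periodic dNLS cell for every coupling `ε`: with
`ω = 1 + 2a²`, phases `φ = (φ₁, φ₁+θ, φ₁+π, φ₁+θ+π)` and
`ψⱼ(t) = a e^{i(φⱼ - ωt)}`, one has
`i ψⱼ' = ψⱼ + 2|ψⱼ|²ψⱼ + ε(ψ_{j+1} + ψ_{j-1})` with indices mod 4. -/
theorem dNLS_family_exact_solution
    (a θ φ1 ε : ℝ) (ha : 0 < a)
    (ω : ℝ) (hω : ω = 1 + 2 * a ^ 2)
    (φ : Fin 4 → ℝ)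
    (hφ : φ = ![φ1, φ1 + θ, φ1 + Real.pi, φ1 + θ + Real.pi])
    (ψ : Fin 4 → ℝ → ℂ)
    (hψ : ∀ (j : Fin 4) (t : ℝ),
      ψ j t = (a : ℂ) * Complex.exp (Complex.I * ((φ j : ℂ) - (ω : ℂ) * (t : ℂ)))) :
    ∀ (j : Fin 4) (t : ℝ),
      HasDerivAt (ψ j)
        (-Complex.I * (ψ j t + 2 * ((‖ψ j t‖ : ℂ)) ^ 2 * ψ j t +
          (ε : ℂ) * (ψ (j + 1) t + ψ (j - 1) t))) t := by
  intro j t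
  have hnorm : ‖ψ j t‖ = a := by
    have e : Complex.I * ((φ j : ℂ) - (ω : ℂ) * (t : ℂ))
        = ((φ j - ω * t : ℝ) : ℂ) * Complex.I := by
      push_cast; ring
    rw [hψ, e, norm_mul, Complex.norm_exp_ofReal_mul_I, mul_one, Complex.norm_real,
      Real.norm_eq_abs, abs_of_pos ha]
  have key : ∀ x : ℝ, Complex.exp (Complex.I * (((x + Real.pi : ℝ) : ℂ) - (ω : ℂ) * (t : ℂ)))
      = - Complex.exp (Complex.I * ((x : ℂ) - (ω : ℂ) * (t : ℂ))) := by
    intro x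
    have e : Complex.I * (((x + Real.pi : ℝ) : ℂ) - (ω : ℂ) * (t : ℂ))
        = Complex.I * ((x : ℂ) - (ω : ℂ) * (t : ℂ)) + Real.pi * Complex.I := by
      push_cast; ring
    rw [e, Complex.exp_add, Complex.exp_pi_mul_I]; ring
  have h2 : ψ 2 t = - ψ 0 t := by
    have e2 : φ 2 = φ 0 + Real.pi := by rw [hφ]; rfl
    rw [hψ, hψ, e2, key]; ring
  have h3 : ψ 3 t = - ψ 1 t := by
    have e3 : φ 3 = φ 1 + Real.pi := by rw [hφ]; rfl
    rw [hψ, hψ, e3, key]; ring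
  have hsum : ψ (j + 1) t + ψ (j - 1) t = 0 := by
    fin_cases j
    · change ψ 1 t + ψ 3 t = 0
      rw [h3]; ring
    · change ψ 2 t + ψ 0 t = 0
      rw [h2]; ring
    · change ψ 3 t + ψ 1 t = 0
      rw [h3]; ring
    · change ψ 0 t + ψ 2 t = 0
      rw [h2]; ring
  rw [hsum, hnorm]
  have hd : HasDerivAt (fun s : ℝ => (s : ℂ)) 1 t := Complex.ofRealCLM.hasDerivAt
  have hd2 := (((((hd.const_mul (ω : ℂ)).const_sub (φ j : ℂ)).const_mul Complex.I).cexp).const_mul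
    (a : ℂ))
  have hf : ψ j = fun s : ℝ =>
      (a : ℂ) * Complex.exp (Complex.I * ((φ j : ℂ) - (ω : ℂ) * (s : ℂ))) := funext (hψ j)
  have hω' : (ω : ℂ) = 1 + 2 * (a : ℂ) ^ 2 := by rw [hω]; push_cast; rfl
  rw [hψ j t, hf]
  refine HasDerivAt.congr_deriv hd2 ?_
  generalize Complex.exp (Complex.I * ((φ j : ℂ) - (ω : ℂ) * (t : ℂ))) = E
  rw [hω']; ring
end
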